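/- arXiv:2504.01272 — 3 statements merged into one kernel-verified Lean document; each statement's English description precedes it below -/
import Mathlib

section
/- Let p, q ≥ 0 be integers with p + q ≤ m and let ω₁, …, ω_p > 0. Then the closure, in the space of real 2m×2m matrices, of the Sp(2m,ℝ)-congruence orbit of N(p,q,ω) is the union over q' = 0, 1, …, q of the Sp(2m,ℝ)-congruence orbits of the matrices N(p,q',ω). In particular the closure of the orbit consists of exactly q+1 orbits, all with the same spectral invariants ω_j² and numerical invariants (p, q') for 0 ≤ q' ≤ q. -/
open Matrix

noncomputable section

/-- The standard symplectic matrix `J = fromBlocks 0 I (-I) 0` on `ℝ^(2m)`,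
indexed by `Fin m ⊕ Fin m`. -/
def sympJ (m : ℕ) : Matrix (Fin m ⊕ Fin m) (Fin m ⊕ Fin m) ℝ :=
  Matrix.fromBlocks 0 1 (-1) 0

/-- The normal form `N(p,q,ω)`: the `2m×2m` diagonal matrix with `j`-th and `(m+j)`-th
diagonal entries `ω_j²` for `j < p`, `(m+j)`-th diagonal entry `1` for `p ≤ j < p+q`,
and all other entries `0`. -/
def NMat (m p q : ℕ) (ω : Fin p → ℝ) :
    Matrix (Fin m ⊕ Fin m) (Fin m ⊕ Fin m) ℝ :=
  Matrix.diagonal fun i => match i with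
    | Sum.inl j => if h : (j : ℕ) < p then (ω ⟨j, h⟩) ^ 2 else 0
    | Sum.inr j => if h : (j : ℕ) < p then (ω ⟨j, h⟩) ^ 2
        else if (j : ℕ) < p + q then 1 else 0

/-- The `Sp(2m,ℝ)`-congruence orbit of a matrix `G`. -/
def sympOrbit (m : ℕ) (G : Matrix (Fin m ⊕ Fin m) (Fin m ⊕ Fin m) ℝ) :
    Set (Matrix (Fin m ⊕ Fin m) (Fin m ⊕ Fin m) ℝ) :=
  {A | ∃ T : Matrix (Fin m ⊕ Fin m) (Fin m ⊕ Fin m) ℝ,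
      Tᵀ * sympJ m * T = sympJ m ∧ A = Tᵀ * G * T}

/-- An endomorphism of a nonzero finite-dimensional real space satisfies a nontrivial relation of
degree at most two on some nonzero vector. -/
theorem exists_quadratic_relation {V : Type*} [AddCommGroup V] [Module ℝ V]
    [FiniteDimensional ℝ V] [Nontrivial V] (f : Module.End ℝ V) :
    ∃ v ≠ 0, ∃ a b c : ℝ, (a ≠ 0 ∨ b ≠ 0 ∨ c ≠ 0) ∧ a • f (f v) + b • f v + c • v = 0 := by
  have hint : IsIntegral ℝ f := Algebra.IsIntegral.isIntegral f
  obtain ⟨q, hq, r, hr⟩ := WfDvdMonoid.exists_irreducible_factor (minpoly.not_isUnit ℝ f)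
    (minpoly.ne_zero hint)
  have hr0 : r ≠ 0 := fun h => minpoly.ne_zero hint (by simp [hr, h])
  have hrf : Polynomial.aeval f r ≠ 0 := fun h => by
    have h1 := Polynomial.natDegree_le_of_dvd (minpoly.dvd ℝ f h) hr0
    rw [hr, Polynomial.natDegree_mul hq.ne_zero hr0] at h1
    have := hq.natDegree_pos
    omega
  obtain ⟨w, hw⟩ : ∃ w, Polynomial.aeval f r w ≠ 0 := by
    by_contra! h
    exact hrf (LinearMap.ext h)
  refine ⟨_, hw, q.coeff 2, q.coeff 1, q.coeff 0, ?_, ?_⟩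
  · by_contra! h
    refine hq.ne_zero (Polynomial.ext fun n => ?_)
    have := hq.natDegree_le_two
    rcases n with _ | _ | _ | n
    · simpa using h.2.2
    · simpa using h.2.1
    · simpa using h.1
    · simpa using Polynomial.coeff_eq_zero_of_natDegree_lt (by omega)
  · have h0 : Polynomial.aeval f q (Polynomial.aeval f r w) = 0 := by
      rw [← Module.End.mul_apply, ← map_mul, ← hr, minpoly.aeval, LinearMap.zero_apply]
    rw [Polynomial.aeval_eq_sum_range' (Nat.lt_succ_of_le hq.natDegree_le_two)] at h0
    simp [Finset.sum_range_succ, pow_two] at h0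
    rw [← h0]
    abel

/-- The pairs of diagonal entries that occur in the symplectic normal form of a positive
semidefinite form. -/
def IsNormalPair (a b : ℝ) : Prop := (0 < a ∧ a = b) ∨ (a = 0 ∧ (b = 0 ∨ b = 1))

section NormalForm

variable {V : Type*} [AddCommGroup V] [Module ℝ V] [FiniteDimensional ℝ V]
  (ω B : LinearMap.BilinForm ℝ V)

/-- A positive semidefinite form on a symplectic space splits off a normal plane. -/
theorem exists_normal_plane [Nontrivial V] (hω : ∀ x y, ω x y = -ω y x)
    (hnd : ∀ x, (∀ y, ω x y = 0) → x = 0) (hB : ∀ x y, B x y = B y x) (hpos : ∀ x, 0 ≤ B x x) :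
    ∃ e f, ω e f = 1 ∧ IsNormalPair (B e e) (B f f) ∧ B e f = 0 ∧
      ∀ y, ω e y = 0 → ω f y = 0 → B e y = 0 ∧ B f y = 0 := by
  have hself : ∀ x, ω x x = 0 := fun x => by linarith [hω x x]
  have hinj : Function.Injective ω :=
    (injective_iff_map_eq_zero ω).2 fun x hx => hnd x fun y => by simp [hx]
  obtain ⟨A, hA⟩ : ∃ A : V →ₗ[ℝ] V, ∀ x y, ω (A x) y = B x y := by
    let E := LinearMap.linearEquivOfInjective (V₂ := Module.Dual ℝ V) ω hinj
      Subspace.dual_finrank_eq.symm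
    refine ⟨E.symm.toLinearMap ∘ₗ B, fun x y => ?_⟩
    have : ω (E.symm (B x)) = B x := E.apply_symm_apply (B x)
    simp [this]
  have hskew : ∀ x y, ω (A x) y = -ω x (A y) := fun x y => by rw [hA, hB, ← hA, hω]
  have hker : ∀ x, B x x = 0 → A x = 0 := fun x hx => by
    refine hnd _ fun y => ?_
    rw [hA]
    have key : ∀ t : ℝ, 0 ≤ B y y + 2 * t * B x y := fun t => by
      have := hpos (y + t • x)
      simp only [map_add, map_smul, LinearMap.add_apply, LinearMap.smul_apply, smul_eq_mul, hx,
        hB y x] at this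
      linarith
    by_contra h
    have := key (-(B y y + 1) / (2 * B x y))
    field_simp at this
    linarith
  by_cases hA0 : ∀ x, A x = 0
  · have hB0 : ∀ x y, B x y = 0 := fun x y => by rw [← hA, hA0]; simp
    obtain ⟨x, hx⟩ := exists_ne (0 : V)
    obtain ⟨y, hy⟩ : ∃ y, ω x y ≠ 0 := by
      by_contra! h
      exact hx (hnd x h)
    exact ⟨x, (ω x y)⁻¹ • y, by simp [hy], Or.inr ⟨hB0 _ _, Or.inl (hB0 _ _)⟩, hB0 _ _,
      fun _ _ _ => ⟨hB0 _ _, hB0 _ _⟩⟩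
  by_cases hA2 : ∀ x, A (A x) = 0
  · push Not at hA0
    obtain ⟨x, hx⟩ := hA0
    have hβ : 0 < B x x := lt_of_le_of_ne (hpos x) fun h => hx (hker x h.symm)
    have hs : 0 < √(B x x) := Real.sqrt_pos.2 hβ
    have hss := Real.mul_self_sqrt hβ.le
    have hBA : ∀ y, B (A x) y = 0 := fun y => by rw [← hA, hA2]; simp
    refine ⟨(√(B x x))⁻¹ • A x, (√(B x x))⁻¹ • x, ?_, Or.inr ⟨?_, Or.inr ?_⟩, ?_,
      fun y hy _ => ⟨?_, ?_⟩⟩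
    · simp only [map_smul, LinearMap.smul_apply, smul_eq_mul, hA]
      field_simp
      linarith
    · simp [hBA]
    · simp only [map_smul, LinearMap.smul_apply, smul_eq_mul]
      field_simp
      linarith
    · simp [hBA]
    · simp [hBA]
    · simpa [hA] using hy
  push Not at hA2
  have hA3 : ∀ x, A (A (A x)) = 0 → A (A x) = 0 := fun x hx =>
    hker _ (by rw [← hA, hskew, hskew, hx]; simp)
  let R := LinearMap.range (A ∘ₗ A)
  have hR : ∀ x ∈ R, A x ∈ R := by
    rintro _ ⟨x, rfl⟩
    exact ⟨A x, rfl⟩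
  have hRinj : ∀ x ∈ R, A x = 0 → x = 0 := by
    rintro _ ⟨x, rfl⟩ h
    exact hA3 x h
  obtain ⟨x₀, hx₀⟩ := hA2
  have : Nontrivial R := ⟨⟨⟨A (A x₀), x₀, rfl⟩, 0, fun h => hx₀ (congrArg Subtype.val h)⟩⟩
  obtain ⟨⟨v, hvR⟩, hv0, a, b, c, habc, hrel⟩ := exists_quadratic_relation (A.restrict hR)
  have hv : v ≠ 0 := fun h => hv0 (Subtype.ext h)
  replace hrel : a • A (A v) + b • A v + c • v = 0 := congrArg Subtype.val hrel
  have hAv : A v ≠ 0 := fun h => hv (hRinj v hvR h)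
  have hAAv : A (A v) ≠ 0 := fun h => hAv (hRinj _ (hR v hvR) h)
  have hβ : 0 < B v v := lt_of_le_of_ne (hpos v) fun h => hAv (hker v h.symm)
  have hγ : 0 < B (A v) (A v) := lt_of_le_of_ne (hpos _) fun h => hAAv (hker _ h.symm)
  have hBvA : B (A v) v = 0 := by rw [← hA, hskew, hself, neg_zero]
  have hb : b = 0 := by
    have h1 : ω (a • A (A v) + b • A v + c • v) v = 0 := by rw [hrel]; simp
    simp only [map_add, map_smul, LinearMap.add_apply, LinearMap.smul_apply, smul_eq_mul, hA,
      hself, hBvA] at h1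
    simpa [hβ.ne'] using h1
  subst hb
  have ha : a ≠ 0 := by
    rintro rfl
    have hc : c = 0 := by simpa [hv] using hrel
    simp [hc] at habc
  obtain ⟨μ, hμ⟩ : ∃ μ : ℝ, A (A v) = -(μ • v) := by
    refine ⟨c / a, smul_right_injective V ha ?_⟩
    simp only [zero_smul, add_zero] at hrel
    simp only [smul_neg, smul_smul, mul_div_cancel₀ c ha]
    exact eq_neg_of_add_eq_zero_left hrel
  have hγβ : B (A v) (A v) = μ * B v v := by
    rw [← hA, hμ, ← hA v v]
    simp [hω v (A v)]
  have hμ0 : 0 < μ := by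
    rw [hγβ] at hγ
    exact pos_of_mul_pos_left hγ hβ.le
  set s := √μ with hs
  have hs0 : 0 < s := Real.sqrt_pos.2 hμ0
  have hss : s * s = μ := Real.mul_self_sqrt hμ0.le
  set k := √(s * B v v) with hk
  have hk0 : 0 < k := Real.sqrt_pos.2 (by positivity)
  have hkk : k * k = s * B v v := Real.mul_self_sqrt (by positivity)
  refine ⟨k⁻¹ • A v, (s * k⁻¹) • v, ?_, Or.inl ⟨?_, ?_⟩, ?_, fun y h1 h2 => ⟨?_, ?_⟩⟩
  · simp only [map_smul, LinearMap.smul_apply, smul_eq_mul, hA]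
    field_simp
    linarith
  · simp only [map_smul, LinearMap.smul_apply, smul_eq_mul]
    positivity
  · simp only [map_smul, LinearMap.smul_apply, smul_eq_mul, hγβ, ← hss]
    ring
  · simp [hBvA]
  · have : ω v y = 0 := by simpa [hs0.ne', hk0.ne'] using h2
    simp [← hA, hμ, this]
  · have : ω (A v) y = 0 := by simpa [hk0.ne'] using h1
    simp [← hA, this]

end NormalForm

/-- Simultaneous normal form of a symplectic form and a positive semidefinite form. -/
theorem exists_symplectic_normal_basis (m : ℕ) {V : Type*} [AddCommGroup V] [Module ℝ V]
    [FiniteDimensional ℝ V] (ω B : LinearMap.BilinForm ℝ V) (hdim : Module.finrank ℝ V = 2 * m)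
    (hω : ∀ x y, ω x y = -ω y x) (hnd : ∀ x, (∀ y, ω x y = 0) → x = 0)
    (hB : ∀ x y, B x y = B y x) (hpos : ∀ x, 0 ≤ B x x) :
    ∃ (e f : Fin m → V) (a b : Fin m → ℝ), (∀ j, IsNormalPair (a j) (b j)) ∧
      (∀ i j, ω (e i) (e j) = 0) ∧ (∀ i j, ω (f i) (f j) = 0) ∧
      (∀ i j, ω (e i) (f j) = if i = j then 1 else 0) ∧
      (∀ i j, B (e i) (e j) = if i = j then a i else 0) ∧
      (∀ i j, B (f i) (f j) = if i = j then b i else 0) ∧ (∀ i j, B (e i) (f j) = 0) := by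
  induction m generalizing V with
  | zero => exact ⟨Fin.elim0, Fin.elim0, Fin.elim0, Fin.elim0, by simp⟩
  | succ m ih =>
    have : Nontrivial V := Module.nontrivial_of_finrank_pos (R := ℝ) (by omega)
    have hself : ∀ x, ω x x = 0 := fun x => by linarith [hω x x]
    obtain ⟨e₀, f₀, h1, hnorm, hef, horth⟩ := exists_normal_plane ω B hω hnd hB hpos
    have h1' : ω f₀ e₀ = -1 := by rw [hω, h1]
    let F : V →ₗ[ℝ] ℝ × ℝ := (ω e₀).prod (ω f₀)
    let U := LinearMap.ker F
    have hU : ∀ y, y ∈ U ↔ ω e₀ y = 0 ∧ ω f₀ y = 0 := fun y => by simp [U, F]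
    have hFs : LinearMap.range F = ⊤ := by
      rw [LinearMap.range_eq_top]
      rintro ⟨s, t⟩
      exact ⟨s • f₀ - t • e₀, by simp [F, h1, h1', hself]⟩
    have hdimU : Module.finrank ℝ U = 2 * m := by
      have := LinearMap.finrank_range_add_finrank_ker F
      rw [hFs, finrank_top, Module.finrank_prod, Module.finrank_self, hdim] at this
      change 1 + 1 + Module.finrank ℝ U = _ at this
      omega
    have hndU : ∀ x : U, (∀ y : U, ω x y = 0) → x = 0 := by
      rintro ⟨x, hx⟩ h
      refine Subtype.ext (hnd x fun y => ?_)
      have hxU := (hU x).1 hx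
      have h2 := h ⟨y - ω e₀ y • f₀ + ω f₀ y • e₀, (hU _).2 (by simp [h1, h1', hself])⟩
      simpa [hω x, hxU.1, hxU.2] using h2
    obtain ⟨e, f, a, b, hab, hee, hff, hefω, heB, hfB, hefB⟩ := ih (V := U)
      (ω.restrict U) (B.restrict U) hdimU (fun x y => hω x y) (fun x hx => hndU x hx)
      (fun x y => hB x y) (fun x => hpos x)
    have hU1 : ∀ x : U, ω e₀ x = 0 := fun x => ((hU x).1 x.2).1
    have hU2 : ∀ x : U, ω f₀ x = 0 := fun x => ((hU x).1 x.2).2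
    have hU3 : ∀ x : U, B e₀ x = 0 := fun x => (horth x (hU1 x) (hU2 x)).1
    have hU4 : ∀ x : U, B f₀ x = 0 := fun x => (horth x (hU1 x) (hU2 x)).2
    have hU5 : ∀ x : U, ω x e₀ = 0 := fun x => by rw [hω, hU1, neg_zero]
    have hU6 : ∀ x : U, ω x f₀ = 0 := fun x => by rw [hω, hU2, neg_zero]
    have hU7 : ∀ x : U, B x e₀ = 0 := fun x => by rw [hB, hU3]
    have hU8 : ∀ x : U, B x f₀ = 0 := fun x => by rw [hB, hU4]
    simp only [LinearMap.BilinForm.restrict_apply, LinearMap.domRestrict_apply]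
      at hee hff hefω heB hfB hefB
    refine ⟨Fin.cons e₀ fun i => e i, Fin.cons f₀ fun i => f i, Fin.cons (B e₀ e₀) a,
      Fin.cons (B f₀ f₀) b, ?_, ?_, ?_, ?_, ?_, ?_, ?_⟩
    · intro j
      cases j using Fin.cases <;> simp [hnorm, hab]
    all_goals
      intro i j
      cases i using Fin.cases <;> cases j using Fin.cases <;>
        simp [hself, h1, hef, hU1, hU2, hU3, hU4, hU5, hU6, hU7, hU8, hee, hff, hefω,
          heB, hfB, hefB, (Fin.succ_ne_zero _).symm]

variable {m : ℕ}

theorem exists_symplectic_congruence_diagonal {G : Matrix (Fin m ⊕ Fin m) (Fin m ⊕ Fin m) ℝ}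
    (hG : Gᵀ = G) (hpos : ∀ x, 0 ≤ x ⬝ᵥ G *ᵥ x) :
    ∃ (T : Matrix (Fin m ⊕ Fin m) (Fin m ⊕ Fin m) ℝ) (a b : Fin m → ℝ),
      Tᵀ * sympJ m * T = sympJ m ∧ (∀ j, IsNormalPair (a j) (b j)) ∧
      Tᵀ * G * T = diagonal (Sum.elim a b) := by
  have hJt : (sympJ m)ᵀ = -sympJ m := by simp [sympJ, fromBlocks_transpose, fromBlocks_neg]
  have hskew : ∀ x y, x ⬝ᵥ sympJ m *ᵥ y = -(y ⬝ᵥ sympJ m *ᵥ x) := fun x y => by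
    rw [dotProduct_mulVec, ← mulVec_transpose, hJt, neg_mulVec, neg_dotProduct, dotProduct_comm]
  have hJJ : sympJ m * sympJ m = -1 := by
    simp [sympJ, fromBlocks_multiply, ← fromBlocks_one, fromBlocks_neg]
  obtain ⟨e, f, a, b, hab, hee, hff, hef, heB, hfB, hefB⟩ := exists_symplectic_normal_basis m
    (Matrix.toBilin' (sympJ m)) (Matrix.toBilin' G) (by simp [two_mul])
    (fun x y => by simpa [Matrix.toBilin'_apply'] using hskew x y)
    (fun x hx => by
      simp only [Matrix.toBilin'_apply'] at hx
      have h1 : sympJ m *ᵥ x = 0 := by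
        refine dotProduct_eq_zero _ fun y => ?_
        rw [dotProduct_comm, hskew, hx, neg_zero]
      have h2 : sympJ m *ᵥ sympJ m *ᵥ x = 0 := by rw [h1, mulVec_zero]
      rwa [mulVec_mulVec, hJJ, neg_mulVec, one_mulVec, neg_eq_zero] at h2)
    (fun x y => by
      simp only [Matrix.toBilin'_apply']
      rw [dotProduct_mulVec, ← mulVec_transpose, hG, dotProduct_comm])
    (fun x => by simpa [Matrix.toBilin'_apply'] using hpos x)
  simp only [Matrix.toBilin'_apply'] at hee hff hef heB hfB hefB
  have hfe : ∀ i j, f i ⬝ᵥ sympJ m *ᵥ e j = if i = j then -1 else 0 := fun i j => by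
    rw [hskew, hef]
    simp [eq_comm, apply_ite]
  have hfeB : ∀ i j, f i ⬝ᵥ G *ᵥ e j = 0 := fun i j => by
    rw [dotProduct_mulVec, ← mulVec_transpose, hG, dotProduct_comm, hefB]
  let T : Matrix (Fin m ⊕ Fin m) (Fin m ⊕ Fin m) ℝ := (Matrix.of (Sum.elim e f))ᵀ
  have hT : ∀ (M : Matrix (Fin m ⊕ Fin m) (Fin m ⊕ Fin m) ℝ) i j,
      (Tᵀ * M * T) i j = Sum.elim e f i ⬝ᵥ M *ᵥ Sum.elim e f j := fun M i j => by
    rw [Matrix.mul_assoc]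
    rfl
  refine ⟨T, a, b, ?_, hab, ?_⟩
  · ext i j
    rw [hT]
    rcases i with i | i <;> rcases j with j | j <;>
      simp only [Sum.elim_inl, Sum.elim_inr, hee, hff, hef, hfe] <;>
      simp [sympJ, one_apply, apply_ite]
  · ext i j
    rw [hT]
    rcases i with i | i <;> rcases j with j | j <;> simp [heB, hfB, hefB, hfeB, diagonal_apply]

theorem det_smul_sympJ_add_diagonal (x : ℝ) (a b : Fin m → ℝ) :
    (x • sympJ m + diagonal (Sum.elim a b)).det = ∏ j, (a j * b j + x ^ 2) := by
  let e : Fin 2 × Fin m ≃ Fin m ⊕ Fin m :=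
    (finTwoEquiv.prodCongr (Equiv.refl _)).trans (Equiv.boolProdEquivSum _)
  have h : (x • sympJ m + diagonal (Sum.elim a b)).submatrix e e
      = blockDiagonal fun j => !![a j, x; -x, b j] := by
    ext ⟨i, j⟩ ⟨i', j'⟩
    fin_cases i <;> fin_cases i' <;>
      simp [e, sympJ, blockDiagonal_apply, finTwoEquiv, one_apply, diagonal_apply,
        apply_ite (Neg.neg : ℝ → ℝ)]
  rw [← det_submatrix_equiv_self e, h, det_blockDiagonal]
  exact Finset.prod_congr rfl fun j _ => by rw [det_fin_two_of]; ring

theorem det_sq_eq_one_of_symplectic {T : Matrix (Fin m ⊕ Fin m) (Fin m ⊕ Fin m) ℝ}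
    (hT : Tᵀ * sympJ m * T = sympJ m) : T.det * T.det = 1 := by
  have hJ : (sympJ m).det ≠ 0 := by
    have := det_smul_sympJ_add_diagonal (m := m) 1 0 0
    simp at this
    simp [this]
  have h := congrArg det hT
  simp only [det_mul, det_transpose] at h
  refine mul_right_cancel₀ hJ ?_
  linarith

theorem det_smul_sympJ_add_congr {T G : Matrix (Fin m ⊕ Fin m) (Fin m ⊕ Fin m) ℝ}
    (hT : Tᵀ * sympJ m * T = sympJ m) (x : ℝ) :
    (x • sympJ m + Tᵀ * G * T).det = (x • sympJ m + G).det := by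
  have h : x • sympJ m + Tᵀ * G * T = Tᵀ * (x • sympJ m + G) * T := by
    conv_lhs => rw [← hT]
    simp [Matrix.mul_add, Matrix.add_mul]
  rw [h, det_mul, det_mul, det_transpose]
  linear_combination (x • sympJ m + G).det * det_sq_eq_one_of_symplectic hT

open Polynomial in
/-- Two families of nonnegative reals with the same polynomial `∏ (x² + aⱼ²)` agree up to a
permutation. -/
theorem exists_perm_of_prod_sq_add_eq {a a' : Fin m → ℝ} (ha : ∀ j, 0 ≤ a j) (ha' : ∀ j, 0 ≤ a' j)
    (h : ∀ x : ℝ, ∏ j, (a j ^ 2 + x ^ 2) = ∏ j, (a' j ^ 2 + x ^ 2)) :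
    ∃ σ : Equiv.Perm (Fin m), a ∘ σ = a' := by
  have hp : ∏ j, (X - C (-(a j ^ 2))) = ∏ j, (X - C (-(a' j ^ 2))) := by
    refine Polynomial.eq_of_infinite_eval_eq _ _ ((Set.Ici_infinite (0 : ℝ)).mono fun x hx => ?_)
    have := h √x
    rw [Real.sq_sqrt hx] at this
    simpa [Polynomial.eval_prod, add_comm] using this
  have hroots : ∀ c : Fin m → ℝ, (∏ j, (X - C (c j))).roots = Finset.univ.val.map c := fun c => by
    rw [Finset.prod_eq_multiset_prod, ← Polynomial.roots_multiset_prod_X_sub_C (Multiset.map c _),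
      Multiset.map_map]
    rfl
  have hm := congrArg (fun P => P.roots.map fun t => √(-t)) hp
  simp only [hroots, Multiset.map_map, Function.comp_def, neg_neg, Real.sqrt_sq (ha _),
    Real.sqrt_sq (ha' _)] at hm
  have hcard : ∀ c, Fintype.card {j // a' j = c} = Fintype.card {j // a j = c} := fun c => by
    have := congrArg (Multiset.count c) hm
    rw [Multiset.count_map, Multiset.count_map] at this
    simp only [Fintype.card_subtype, Finset.card, Finset.filter_val, eq_comm (b := c)]
    exact this.symm
  refine ⟨Equiv.ofFiberEquiv (f := a') (g := a) fun c => Fintype.equivOfCardEq (hcard c), ?_⟩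
  exact funext fun j => Equiv.ofFiberEquiv_map _ j

theorem NMat_eq_diagonal_elim (m p q : ℕ) (ω : Fin p → ℝ) :
    NMat m p q ω = diagonal (Sum.elim
      (fun j : Fin m => if h : (j : ℕ) < p then ω ⟨j, h⟩ ^ 2 else 0) fun j : Fin m =>
        if h : (j : ℕ) < p then ω ⟨j, h⟩ ^ 2 else if (j : ℕ) < p + q then 1 else 0) := by
  rw [NMat]
  congr 1
  ext (j | j) <;> rfl

theorem exists_symplectic_congruence_perm (σ : Equiv.Perm (Fin m)) (a b : Fin m → ℝ) :
    ∃ T : Matrix (Fin m ⊕ Fin m) (Fin m ⊕ Fin m) ℝ, Tᵀ * sympJ m * T = sympJ m ∧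
      Tᵀ * diagonal (Sum.elim a b) * T = diagonal (Sum.elim (a ∘ σ) (b ∘ σ)) := by
  let τ := σ.sumCongr σ
  let T : Matrix (Fin m ⊕ Fin m) (Fin m ⊕ Fin m) ℝ := of fun i j => if i = τ j then 1 else 0
  have h : ∀ M : Matrix (Fin m ⊕ Fin m) (Fin m ⊕ Fin m) ℝ, Tᵀ * M * T = M.submatrix τ τ := by
    intro M
    ext i j
    simp [T, mul_apply]
  refine ⟨T, ?_, ?_⟩
  · rw [h]
    ext (i | i) (j | j) <;> simp [τ, sympJ, one_apply]
  · rw [h, submatrix_diagonal_equiv]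
    congr 1
    ext (i | i) <;> simp [τ]

theorem sympJ_congr_mul {S T : Matrix (Fin m ⊕ Fin m) (Fin m ⊕ Fin m) ℝ}
    (hS : Sᵀ * sympJ m * S = sympJ m) (hT : Tᵀ * sympJ m * T = sympJ m) :
    (S * T)ᵀ * sympJ m * (S * T) = sympJ m := by
  have : (S * T)ᵀ * sympJ m * (S * T) = Tᵀ * (Sᵀ * sympJ m * S) * T := by
    simp only [transpose_mul, Matrix.mul_assoc]
  rw [this, hS, hT]

theorem sympOrbit_congr_mem {G A S : Matrix (Fin m ⊕ Fin m) (Fin m ⊕ Fin m) ℝ}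
    (hS : Sᵀ * sympJ m * S = sympJ m) (hA : A ∈ sympOrbit m G) : Sᵀ * A * S ∈ sympOrbit m G := by
  obtain ⟨T, hT, rfl⟩ := hA
  exact ⟨T * S, sympJ_congr_mul hT hS, by simp only [transpose_mul, Matrix.mul_assoc]⟩

theorem closure_sympOrbit_congr_mem {G A S : Matrix (Fin m ⊕ Fin m) (Fin m ⊕ Fin m) ℝ}
    (hS : Sᵀ * sympJ m * S = sympJ m) (hA : A ∈ closure (sympOrbit m G)) :
    Sᵀ * A * S ∈ closure (sympOrbit m G) :=
  map_mem_closure (f := fun X => Sᵀ * X * S) (by fun_prop) hA fun _ => sympOrbit_congr_mem hS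

theorem mem_sympOrbit_of_congr_eq {G D T : Matrix (Fin m ⊕ Fin m) (Fin m ⊕ Fin m) ℝ}
    (hT : Tᵀ * sympJ m * T = sympJ m) (h : Tᵀ * G * T = D) : G ∈ sympOrbit m D := by
  have hdet : IsUnit T.det := IsUnit.of_mul_eq_one _ (det_sq_eq_one_of_symplectic hT)
  have key : ∀ X Y : Matrix (Fin m ⊕ Fin m) (Fin m ⊕ Fin m) ℝ, Tᵀ * X * T = Y →
      X = T⁻¹ᵀ * Y * T⁻¹ := fun X Y hXY => by
    rw [← hXY, transpose_nonsing_inv, Matrix.mul_assoc Tᵀ, nonsing_inv_mul_cancel_left _ _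
      (by rwa [det_transpose]), mul_nonsing_inv_cancel_right _ _ hdet]
  exact ⟨T⁻¹, (key _ _ hT).symm, key _ _ h⟩

/-- The rank does not increase on passing to the closure of an orbit; for diagonal matrices this
bounds the number of nonzero entries. -/
theorem card_support_le_of_diagonal_mem_closure {d d' : Fin m ⊕ Fin m → ℝ}
    (h : diagonal d' ∈ closure (sympOrbit m (diagonal d))) :
    Fintype.card {i // d' i ≠ 0} ≤ Fintype.card {i // d i ≠ 0} := by
  by_contra! hlt
  let ι : {i // d' i ≠ 0} → Fin m ⊕ Fin m := Subtype.val
  have hclosed : IsClosed {X : Matrix (Fin m ⊕ Fin m) (Fin m ⊕ Fin m) ℝ |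
      (X.submatrix ι ι).det = 0} :=
    isClosed_eq (Continuous.matrix_det (by fun_prop)) continuous_const
  have hsub : sympOrbit m (diagonal d) ⊆ {X | (X.submatrix ι ι).det = 0} := by
    rintro _ ⟨T, -, rfl⟩
    by_contra hne
    have h1 := rank_of_isUnit _ ((isUnit_iff_isUnit_det _).2 (isUnit_iff_ne_zero.2 hne))
    have h2 := rank_submatrix_le (Tᵀ * diagonal d * T) ι ι
    have h3 := (rank_mul_le_left (Tᵀ * diagonal d) T).trans (rank_mul_le_right Tᵀ (diagonal d))
    rw [rank_diagonal] at h3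
    omega
  have h0 := closure_minimal hsub hclosed h
  simp only [Set.mem_ofPred_eq, ι, submatrix_diagonal _ _ Subtype.val_injective, det_diagonal] at h0
  exact Finset.prod_ne_zero_iff.2 (fun i _ => i.2) h0

theorem NMat_mem_closure_sympOrbit (m p : ℕ) {q q' : ℕ} (hq : q' ≤ q) (ω : Fin p → ℝ) :
    NMat m p q' ω ∈ closure (sympOrbit m (NMat m p q ω)) := by
  let c : ℝ → Fin m → ℝ := fun t j => if (j : ℕ) < p + q' then 1 else t
  let N : ℝ → Matrix (Fin m ⊕ Fin m) (Fin m ⊕ Fin m) ℝ := fun t =>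
    NMat m p q' ω + t ^ 2 • (NMat m p q ω - NMat m p q' ω)
  have hN : Filter.Tendsto N (nhdsWithin 0 {0}ᶜ) (nhds (NMat m p q' ω)) := by
    have : Continuous N := by fun_prop
    simpa [N] using (this.tendsto 0).mono_left nhdsWithin_le_nhds
  refine mem_closure_of_tendsto hN (eventually_mem_nhdsWithin.mono fun t ht => ?_)
  have ht : t ≠ 0 := ht
  have hc : ∀ j, c t j ≠ 0 := fun j => by simp only [c]; split_ifs <;> simp [ht]
  refine ⟨diagonal (Sum.elim (fun j => (c t j)⁻¹) (c t)), ?_, ?_⟩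
  · ext (i | i) (j | j) <;> simp [sympJ, one_apply] <;> split_ifs <;> simp_all
  · simp only [N, NMat_eq_diagonal_elim, diagonal_transpose, diagonal_mul_diagonal, diagonal_sub,
      ← diagonal_smul, diagonal_add]
    congr 1
    ext (j | j)
    · by_cases hj : (j : ℕ) < p
      · simp [c, hj, show (j : ℕ) < p + q' by omega]
      · simp [hj]
    · by_cases hj : (j : ℕ) < p
      · simp [c, hj, show (j : ℕ) < p + q' by omega]
      · by_cases hj' : (j : ℕ) < p + q'
        · simp [c, hj, hj', show (j : ℕ) < p + q by omega]
        · simp [c, hj, hj', pow_two]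

/-- Reorder the coordinates from `p` on so that those satisfying `Q` come first. -/
theorem exists_perm_sort_tail {p : ℕ} (hp : p ≤ m) (Q : Fin m → Prop) :
    ∃ (k : ℕ) (σ : Equiv.Perm (Fin m)), p + k ≤ m ∧ (∀ j : Fin m, (j : ℕ) < p → σ j = j) ∧
      ∀ j : Fin m, ¬ (j : ℕ) < p → ¬ (σ j : ℕ) < p ∧ (Q (σ j) ↔ (j : ℕ) < p + k) := by
  classical
  let S := {j : Fin m // ¬ (j : ℕ) < p}
  let k := Fintype.card {s : S // Q s}
  have hk : p + k ≤ m := by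
    have h1 : k ≤ Fintype.card S := Fintype.card_subtype_le _
    have h2 : Fintype.card S ≤ Fintype.card (Fin (m - p)) :=
      Fintype.card_le_of_injective (fun s : S => (⟨s.1 - p, by have := s.2; omega⟩ : Fin (m - p)))
        fun s t hst => by
          have := s.2
          have := t.2
          simp only [Fin.mk.injEq] at hst
          exact Subtype.ext (Fin.ext (by omega))
    rw [Fintype.card_fin] at h2
    omega
  let e : {s : S // (s.1 : ℕ) < p + k} ≃ Fin k :=
    { toFun := fun s => ⟨s.1.1 - p, by have := s.2; have := s.1.2; omega⟩
      invFun := fun i => ⟨⟨⟨p + i, by omega⟩, by simp⟩, by simp⟩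
      left_inv := fun s => by
        have := s.1.2
        exact Subtype.ext (Subtype.ext (Fin.ext (by simp; omega)))
      right_inv := fun i => by simp }
  let e' : {s : S // (s.1 : ℕ) < p + k} ≃ {s : S // Q s} := e.trans (Fintype.equivFin _).symm
  let τ : Equiv.Perm S := e'.extendSubtype
  refine ⟨k, Equiv.Perm.ofSubtype τ, hk, fun j hj => ?_, fun j hj => ?_⟩
  · exact Equiv.Perm.ofSubtype_apply_of_not_mem τ (by simpa using hj)
  · rw [Equiv.Perm.ofSubtype_apply_of_mem τ hj]
    refine ⟨(τ ⟨j, hj⟩).2, fun h => ?_, fun h => e'.extendSubtype_mem ⟨j, hj⟩ h⟩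
    by_contra hn
    exact e'.extendSubtype_not_mem ⟨j, hj⟩ hn h

theorem isSymm_of_mem_closure_sympOrbit {G A : Matrix (Fin m ⊕ Fin m) (Fin m ⊕ Fin m) ℝ}
    (hG : Gᵀ = G) (hA : A ∈ closure (sympOrbit m G)) : Aᵀ = A := by
  refine closure_minimal (t := {X | Xᵀ = X}) ?_ (isClosed_eq (by fun_prop) continuous_id) hA
  rintro _ ⟨T, -, rfl⟩
  simp [hG, Matrix.mul_assoc]

theorem nonneg_of_mem_closure_sympOrbit {G A : Matrix (Fin m ⊕ Fin m) (Fin m ⊕ Fin m) ℝ}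
    (hG : ∀ x, 0 ≤ x ⬝ᵥ G *ᵥ x) (hA : A ∈ closure (sympOrbit m G)) (x : Fin m ⊕ Fin m → ℝ) :
    0 ≤ x ⬝ᵥ A *ᵥ x := by
  refine closure_minimal (t := {X | 0 ≤ x ⬝ᵥ X *ᵥ x}) ?_
    (isClosed_le continuous_const (by fun_prop)) hA
  rintro _ ⟨T, -, rfl⟩
  have := hG (T *ᵥ x)
  rwa [Set.mem_ofPred_eq, ← mulVec_mulVec, ← mulVec_mulVec, dotProduct_mulVec, vecMul_transpose]

theorem det_smul_sympJ_add_of_mem_closure {G A : Matrix (Fin m ⊕ Fin m) (Fin m ⊕ Fin m) ℝ}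
    (hA : A ∈ closure (sympOrbit m G)) (x : ℝ) :
    (x • sympJ m + A).det = (x • sympJ m + G).det := by
  refine closure_minimal (t := {X | (x • sympJ m + X).det = (x • sympJ m + G).det}) ?_
    (isClosed_eq (Continuous.matrix_det (by fun_prop)) continuous_const) hA
  rintro _ ⟨T, hT, rfl⟩
  exact det_smul_sympJ_add_congr hT x

theorem exists_mem_sympOrbit_of_mem_closure {p q : ℕ} (hpq : p + q ≤ m) {ω : Fin p → ℝ}
    (hω : ∀ j, 0 < ω j) {G : Matrix (Fin m ⊕ Fin m) (Fin m ⊕ Fin m) ℝ}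
    (hG : G ∈ closure (sympOrbit m (NMat m p q ω))) :
    ∃ q' ≤ q, G ∈ sympOrbit m (NMat m p q' ω) := by
  have hsymm : Gᵀ = G := isSymm_of_mem_closure_sympOrbit (by simp [NMat]) hG
  have hpos : ∀ x, 0 ≤ x ⬝ᵥ G *ᵥ x := by
    refine nonneg_of_mem_closure_sympOrbit (fun x => ?_) hG
    simp only [NMat, mulVec_diagonal, dotProduct]
    refine Finset.sum_nonneg fun i _ => ?_
    have : ∀ d : ℝ, 0 ≤ d → 0 ≤ x i * (d * x i) := fun d hd => by
      nlinarith [mul_nonneg hd (mul_self_nonneg (x i))]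
    refine this _ ?_
    rcases i with i | i <;> dsimp only <;> split_ifs <;> positivity
  obtain ⟨T, a, b, hT, hab, hTG⟩ := exists_symplectic_congruence_diagonal hsymm hpos
  let α : Fin m → ℝ := fun j => if h : (j : ℕ) < p then ω ⟨j, h⟩ ^ 2 else 0
  have hα : ∀ j, 0 ≤ α j := fun j => by simp only [α]; split_ifs <;> positivity
  have hα0 : ∀ j : Fin m, (j : ℕ) < p ↔ 0 < α j := fun j => by
    by_cases hj : (j : ℕ) < p
    · simp [α, hj, hω]
    · simp [α, hj]
  have hD := closure_sympOrbit_congr_mem hT hG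
  obtain ⟨σ, hσ⟩ : ∃ σ : Equiv.Perm (Fin m), a ∘ σ = α := by
    refine exists_perm_of_prod_sq_add_eq (fun j => ?_) hα fun x => ?_
    · rcases hab j with h | h <;> linarith [h.1]
    · have h := det_smul_sympJ_add_of_mem_closure hD x
      rw [hTG, NMat_eq_diagonal_elim, det_smul_sympJ_add_diagonal,
        det_smul_sympJ_add_diagonal] at h
      convert h using 3 with j _ j _
      · rcases hab j with ⟨-, h⟩ | ⟨h, -⟩ <;> simp [h, pow_two]
      · by_cases hj : (j : ℕ) < p <;> simp [α, hj]
        ring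
  have hpair : ∀ j, IsNormalPair (α j) (b (σ j)) := fun j => by
    rw [← hσ]
    exact hab _
  obtain ⟨k, τ, hk, hτ1, hτ2⟩ := exists_perm_sort_tail (by omega : p ≤ m) fun j => b (σ j) = 1
  obtain ⟨P, hP, hPD⟩ := exists_symplectic_congruence_perm (τ.trans σ) a b
  have hN : (T * P)ᵀ * G * (T * P) = NMat m p k ω := by
    have : (T * P)ᵀ * G * (T * P) = Pᵀ * (Tᵀ * G * T) * P := by
      simp only [transpose_mul, Matrix.mul_assoc]
    rw [this, hTG, hPD, NMat_eq_diagonal_elim]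
    congr 1
    have ha : ∀ j, a ((τ.trans σ) j) = α (τ j) := fun j => congrFun hσ (τ j)
    ext (j | j)
    · simp only [Sum.elim_inl, Function.comp_apply, ha]
      by_cases hj : (j : ℕ) < p
      · rw [hτ1 j hj]
      · simp [α, hj, (hτ2 j hj).1]
    · simp only [Sum.elim_inr, Function.comp_apply, Equiv.trans_apply]
      by_cases hj : (j : ℕ) < p
      · rw [hτ1 j hj]
        rcases hpair j with h | h
        · rw [← h.2]
          simp [α, hj]
        · exact absurd h.1 ((hα0 j).1 hj).ne'
      · obtain ⟨h1, h2⟩ := hτ2 j hj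
        simp only [hj, dite_false, ← h2]
        split_ifs with h3
        · exact h3
        · rcases hpair (τ j) with h | h
          · exact absurd ((hα0 _).2 h.1) h1
          · exact h.2.resolve_right h3
  have hTP := sympJ_congr_mul hT hP
  refine ⟨k, ?_, mem_sympOrbit_of_congr_eq hTP hN⟩
  by_contra! hlt
  have hcl := closure_sympOrbit_congr_mem hTP hG
  rw [hN] at hcl
  refine (card_support_le_of_diagonal_mem_closure hcl).not_gt
    (Fintype.card_lt_of_injective_of_notMem (fun i => ⟨i.1, ?_⟩) (fun i j hij => ?_)
      (b := ⟨Sum.inr ⟨p + q, by omega⟩, by simp [hlt]⟩) ?_)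
  · obtain ⟨i | i, hi⟩ := i
    · exact hi
    · by_cases hj : (i : ℕ) < p
      · simpa [hj] using hi
      · have : (i : ℕ) < p + q := by simpa [hj] using hi
        simp [hj, show (i : ℕ) < p + k by omega]
  · exact Subtype.ext (Subtype.mk.inj hij)
  · rintro ⟨⟨i, hi⟩, h⟩
    obtain rfl : i = Sum.inr ⟨p + q, by omega⟩ := congrArg Subtype.val h
    simp at hi

/-- The closure of the symplectic congruence orbit of `N(p,q,ω)` is the union of the
orbits of `N(p,q',ω)` for `0 ≤ q' ≤ q`. -/
theorem closure_sympOrbit_normal_form (m p q : ℕ) (hpq : p + q ≤ m)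
    (ω : Fin p → ℝ) (hω : ∀ j, 0 < ω j) :
    closure (sympOrbit m (NMat m p q ω))
      = ⋃ q' ∈ Finset.range (q + 1), sympOrbit m (NMat m p q' ω) := by
  ext G
  simp only [Set.mem_iUnion, Finset.mem_range, Nat.lt_succ_iff, exists_prop]
  refine ⟨exists_mem_sympOrbit_of_mem_closure hpq hω, ?_⟩
  rintro ⟨q', hq', T, hT, rfl⟩
  exact closure_sympOrbit_congr_mem hT (NMat_mem_closure_sympOrbit m p hq' ω)
end
end

section
/- Let Z be a real d×(2m) matrix and suppose there exist T ∈ Sp(2m,ℝ), integers p, q ≥ 0 with p+q ≤ m, and positive reals ω₁,…,ω_p with Tᵀ·(Zᵀ·Z)·T = N(p,q,ω). Then rank(Zᵀ·Z) = rank(Z) = 2p + q, rank(Z·J·Zᵀ) = 2p, and the inequalities 2p + q ≤ d, 2p + q ≤ 2m, and q ≤ d - 2p hold. In particular Z·J·Zᵀ = 0 if and only if p = 0. -/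
open Matrix

noncomputable section

theorem sympJ_eq_neg_J (m : ℕ) : sympJ m = -J (Fin m) ℝ := by
  simp [sympJ, J, fromBlocks_neg]

theorem isUnit_det_sympJ (m : ℕ) : IsUnit (sympJ m).det := by
  rw [sympJ_eq_neg_J, det_neg]
  exact ((isUnit_one.neg).pow _).mul (isUnit_det_J (Fin m) ℝ)

theorem mem_symplecticGroup_of_sympJ {m : ℕ} {T : Matrix (Fin m ⊕ Fin m) (Fin m ⊕ Fin m) ℝ}
    (hT : Tᵀ * sympJ m * T = sympJ m) : T ∈ symplecticGroup (Fin m) ℝ := by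
  rw [SymplecticGroup.mem_iff']
  simpa [sympJ_eq_neg_J] using hT

theorem rank_eq_zero_iff_eq_zero {l n : Type*} [Finite l] [Fintype n] (A : Matrix l n ℝ) :
    A.rank = 0 ↔ A = 0 := by
  refine ⟨fun h => ?_, fun h => h ▸ rank_zero⟩
  rw [Matrix.rank_eq_finrank_span_cols, Submodule.finrank_eq_zero, Submodule.span_eq_bot] at h
  ext i j
  exact congrFun (h (A.col j) ⟨j, rfl⟩) i

theorem rank_transpose_mul_mul {l n k : Type*} [Fintype l] [Fintype n] [Fintype k]
    (A : Matrix l n ℝ) (B : Matrix n k ℝ) : (Aᵀ * (A * B)).rank = (A * B).rank := by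
  refine le_antisymm (rank_mul_le_right _ _) ?_
  rw [← rank_transpose_mul_self (A * B), transpose_mul, Matrix.mul_assoc]
  exact rank_mul_le_right _ _

theorem rank_mul_mul_transpose {l n : Type*} [Fintype l] [Fintype n]
    (A : Matrix l n ℝ) (X : Matrix n n ℝ) :
    (A * X * Aᵀ).rank = (Aᵀ * A * X * (Aᵀ * A)).rank := by
  rw [Matrix.mul_assoc A, ← rank_transpose_mul_mul, ← rank_transpose,
    show (Aᵀ * (A * (X * Aᵀ)))ᵀ = A * (Xᵀ * Aᵀ * A) by
      simp only [transpose_mul, transpose_transpose, Matrix.mul_assoc],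
    ← rank_transpose_mul_mul, ← rank_transpose]
  simp only [transpose_mul, transpose_transpose, Matrix.mul_assoc]

theorem rank_NMat {m p q : ℕ} (hpq : p + q ≤ m) {ω : Fin p → ℝ} (hω : ∀ j, 0 < ω j) :
    (NMat m p q ω).rank = 2 * p + q := by
  classical
  have hl (j : Fin m) : (if h : (j : ℕ) < p then (ω ⟨j, h⟩) ^ 2 else 0) ≠ 0 ↔ (j : ℕ) < p := by
    split_ifs with h <;> simp [h, (hω _).ne']
  have hr (j : Fin m) : (if h : (j : ℕ) < p then (ω ⟨j, h⟩) ^ 2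
      else if (j : ℕ) < p + q then 1 else 0) ≠ 0 ↔ (j : ℕ) < p + q := by
    split_ifs with h h' <;> simp [(hω _).ne'] <;> omega
  rw [NMat, rank_diagonal, Fintype.card_subtype, Finset.card_filter, Fintype.sum_sum_type]
  simp only [hl, hr, ← Finset.card_filter, Fin.card_filter_val_lt]
  omega

theorem NMat_mul_sympJ_mul_NMat (m p q : ℕ) (ω : Fin p → ℝ) :
    NMat m p q ω * sympJ m * NMat m p q ω =
      diagonal (Sum.elim
        (fun j : Fin m => if h : (j : ℕ) < p then (ω ⟨j, h⟩) ^ 4 else 0)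
        (fun j : Fin m => if h : (j : ℕ) < p then (ω ⟨j, h⟩) ^ 4 else 0)) * sympJ m := by
  ext (i | i) (j | j) <;>
    simp only [NMat, sympJ, mul_diagonal, diagonal_mul, fromBlocks_apply₁₁, fromBlocks_apply₁₂,
      fromBlocks_apply₂₁, fromBlocks_apply₂₂, Sum.elim_inl, Sum.elim_inr, Matrix.zero_apply, Matrix.neg_apply,
      one_apply, mul_zero, zero_mul] <;>
    by_cases hij : i = j <;> simp [hij] <;>
    split_ifs <;> ring

theorem rank_NMat_mul_sympJ_mul_NMat {m p : ℕ} (hp : p ≤ m) (q : ℕ) {ω : Fin p → ℝ}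
    (hω : ∀ j, 0 < ω j) : (NMat m p q ω * sympJ m * NMat m p q ω).rank = 2 * p := by
  classical
  have hl (j : Fin m) : (if h : (j : ℕ) < p then (ω ⟨j, h⟩) ^ 4 else 0) ≠ 0 ↔ (j : ℕ) < p := by
    split_ifs with h <;> simp [h, (hω _).ne']
  rw [NMat_mul_sympJ_mul_NMat, rank_mul_eq_left_of_isUnit_det _ _ (isUnit_det_sympJ m),
    rank_diagonal, Fintype.card_subtype, Finset.card_filter, Fintype.sum_sum_type]
  simp only [Sum.elim_inl, Sum.elim_inr, hl, ← Finset.card_filter, Fin.card_filter_val_lt]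
  omega

/-- If the Gram matrix of `Z` is symplectically congruent to `N(p,q,ω)` then
`rank(ZᵀZ) = rank(Z) = 2p+q`, `rank(Z·J·Zᵀ) = 2p`, the inequalities
`2p+q ≤ d`, `2p+q ≤ 2m`, `q ≤ d - 2p` hold, and the angular momentum vanishes
iff `p = 0`. -/
theorem rank_of_gram_normal_form (d m p q : ℕ) (hpq : p + q ≤ m)
    (Z : Matrix (Fin d) (Fin m ⊕ Fin m) ℝ)
    (ω : Fin p → ℝ) (hω : ∀ j, 0 < ω j)
    (T : Matrix (Fin m ⊕ Fin m) (Fin m ⊕ Fin m) ℝ)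
    (hT : Tᵀ * sympJ m * T = sympJ m)
    (hN : Tᵀ * (Zᵀ * Z) * T = NMat m p q ω) :
    (Zᵀ * Z).rank = 2 * p + q ∧
    Z.rank = 2 * p + q ∧
    (Z * sympJ m * Zᵀ).rank = 2 * p ∧
    2 * p + q ≤ d ∧ 2 * p + q ≤ 2 * m ∧ q ≤ d - 2 * p ∧
    (Z * sympJ m * Zᵀ = 0 ↔ p = 0) := by
  have hmem := mem_symplecticGroup_of_sympJ hT
  have hdet : IsUnit T.det := SymplecticGroup.symplectic_det hmem
  have hdet' : IsUnit Tᵀ.det := by rwa [det_transpose]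
  have hJ : T * sympJ m * Tᵀ = sympJ m := by
    simpa [sympJ_eq_neg_J] using SymplecticGroup.mem_iff.mp hmem
  have hgram : (Zᵀ * Z).rank = 2 * p + q := by
    rw [← rank_NMat hpq hω, ← hN, rank_mul_eq_left_of_isUnit_det _ _ hdet,
      rank_mul_eq_right_of_isUnit_det _ _ hdet']
  have hZ : Z.rank = 2 * p + q := by rw [← rank_transpose_mul_self, hgram]
  have hN' : (Z * T)ᵀ * (Z * T) = NMat m p q ω := by
    rw [← hN, transpose_mul]
    simp only [Matrix.mul_assoc]
  have hang : (Z * sympJ m * Zᵀ).rank = 2 * p := by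
    have : Z * sympJ m * Zᵀ = Z * T * sympJ m * (Z * T)ᵀ := by
      nth_rw 1 [← hJ]
      simp only [transpose_mul, Matrix.mul_assoc]
    rw [this, rank_mul_mul_transpose, hN',
      rank_NMat_mul_sympJ_mul_NMat ((Nat.le_add_right p q).trans hpq) q hω]
  have hd : 2 * p + q ≤ d := by simpa [hZ] using Z.rank_le_card_height
  refine ⟨hgram, hZ, hang, hd, by omega, by omega, ?_⟩
  rw [← rank_eq_zero_iff_eq_zero, hang]
  omega
end
end

section
/- Let m ≥ 2 and let Z be a real 3×(2m) matrix whose angular momentum L = Z·J·Zᵀ is nonzero, and let ω > 0 be the unique positive real with trace(L²) = -2·ω⁴. If rank(Z) = 3, then there exists T ∈ Sp(2m,ℝ) with Tᵀ·(Zᵀ·Z)·T = N(1,1,(ω)); if rank(Z) = 2, then there exists T ∈ Sp(2m,ℝ) with Tᵀ·(Zᵀ·Z)·T = N(1,0,(ω)). Moreover rank(Z) = 1 is impossible when L ≠ 0. (This identifies the two strata, spatial and planar, of the reduced spatial n-body problem at nonzero angular momentum as the two Sp(2m,ℝ)-congruence orbits sharing the spectral invariant ω² = ‖L‖², with the planar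 orbit in the closure of the spatial one.) -/
open Matrix

noncomputable section

/-- The vectors `e i`, `f i` with `i < k` form a hyperbolic family for the bilinear form `B`. -/
structure IsHyperbolicFamily {K V : Type*} [Field K] [AddCommGroup V] [Module K V]
    (B : LinearMap.BilinForm K V) (k : ℕ) (e f : ℕ → V) : Prop where
  left_left : ∀ i < k, ∀ j < k, B (e i) (e j) = 0
  right_right : ∀ i < k, ∀ j < k, B (f i) (f j) = 0
  left_right : ∀ i < k, ∀ j < k, B (e i) (f j) = if i = j then 1 else 0

namespace IsHyperbolicFamily

variable {K V : Type*} [Field K] [AddCommGroup V] [Module K V] {B : LinearMap.BilinForm K V}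
  {k : ℕ} {e f : ℕ → V}

/-- A nonzero vector orthogonal to a hyperbolic family can be added to it as a right vector. -/
theorem exists_succ_of_orthogonal (h : IsHyperbolicFamily B k e f) (hB : B.IsAlt)
    (hn : ∀ x ≠ 0, ∃ y, B y x ≠ 0) {x : V} (hx : x ≠ 0)
    (hex : ∀ i < k, B (e i) x = 0) (hfx : ∀ i < k, B (f i) x = 0) :
    ∃ e' f' : ℕ → V, IsHyperbolicFamily B (k + 1) e' f' ∧
      (∀ i < k, e' i = e i) ∧ (∀ i < k, f' i = f i) ∧ f' k = x := by
  obtain ⟨y, hy⟩ := hn x hx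
  set w : V := (B y x)⁻¹ • y with hw
  have hwx : B w x = 1 := by simp [hw, hy]
  set v : V := w - ∑ i ∈ Finset.range k, (B w (f i) • e i - B w (e i) • f i) with hv
  have hfe : ∀ i < k, ∀ j < k, B (f i) (e j) = if i = j then -1 else 0 := by
    intro i hi j hj
    rw [← hB.neg_eq, h.left_right j hj i hi]
    rcases eq_or_ne i j with rfl | hij
    · simp
    · simp [hij, hij.symm]
  have hve : ∀ j < k, B v (e j) = 0 := by
    intro j hj
    have : ∑ i ∈ Finset.range k, (B w (f i) * B (e i) (e j) - B w (e i) * B (f i) (e j))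
        = ∑ i ∈ Finset.range k, if i = j then B w (e i) else 0 := by
      refine Finset.sum_congr rfl fun i hi => ?_
      rw [Finset.mem_range] at hi
      rw [h.left_left i hi j hj, hfe i hi j hj]
      split_ifs <;> simp
    simp [hv, LinearMap.sum_apply, -Finset.sum_sub_distrib, this, hj]
  have hvf : ∀ j < k, B v (f j) = 0 := by
    intro j hj
    have : ∑ i ∈ Finset.range k, (B w (f i) * B (e i) (f j) - B w (e i) * B (f i) (f j))
        = ∑ i ∈ Finset.range k, if i = j then B w (f i) else 0 := by
      refine Finset.sum_congr rfl fun i hi => ?_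
      rw [Finset.mem_range] at hi
      rw [h.right_right i hi j hj, h.left_right i hi j hj]
      split_ifs <;> simp
    simp [hv, LinearMap.sum_apply, -Finset.sum_sub_distrib, this, hj]
  have hvx : B v x = 1 := by
    have : ∑ i ∈ Finset.range k, (B w (f i) * B (e i) x - B w (e i) * B (f i) x) = 0 := by
      refine Finset.sum_eq_zero fun i hi => ?_
      rw [Finset.mem_range] at hi
      rw [hex i hi, hfx i hi]
      simp
    simp [hv, LinearMap.sum_apply, -Finset.sum_sub_distrib, this, hwx]
  have hev : ∀ j < k, B (e j) v = 0 := fun j hj => by rw [← hB.neg_eq, hve j hj, neg_zero]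
  have hxf : ∀ j < k, B x (f j) = 0 := fun j hj => by rw [← hB.neg_eq, hfx j hj, neg_zero]
  refine ⟨Function.update e k v, Function.update f k x, ⟨?_, ?_, ?_⟩, ?_, ?_, by simp⟩
  · intro i hi j hj
    rcases Nat.lt_succ_iff_lt_or_eq.1 hi with hi | rfl <;>
      rcases Nat.lt_succ_iff_lt_or_eq.1 hj with hj | rfl
    · simpa [hi.ne, hj.ne] using h.left_left i hi j hj
    · simpa [hi.ne] using hev i hi
    · simpa [hj.ne] using hve j hj
    · simpa using hB v
  · intro i hi j hj
    rcases Nat.lt_succ_iff_lt_or_eq.1 hi with hi | rfl <;>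
      rcases Nat.lt_succ_iff_lt_or_eq.1 hj with hj | rfl
    · simpa [hi.ne, hj.ne] using h.right_right i hi j hj
    · simpa [hi.ne] using hfx i hi
    · simpa [hj.ne] using hxf j hj
    · simpa using hB x
  · intro i hi j hj
    rcases Nat.lt_succ_iff_lt_or_eq.1 hi with hi | rfl <;>
      rcases Nat.lt_succ_iff_lt_or_eq.1 hj with hj | rfl
    · simpa [hi.ne, hj.ne] using h.left_right i hi j hj
    · simpa [hi.ne] using hex i hi
    · simpa [hj.ne, hj.ne'] using hvf j hj
    · simpa using hvx
  · intro i hi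
    simp [hi.ne]
  · intro i hi
    simp [hi.ne]

theorem exists_succ [FiniteDimensional K V] (h : IsHyperbolicFamily B k e f) (hB : B.IsAlt)
    (hn : ∀ x ≠ 0, ∃ y, B y x ≠ 0) (hk : 2 * k < Module.finrank K V) :
    ∃ e' f' : ℕ → V, IsHyperbolicFamily B (k + 1) e' f' ∧
      (∀ i < k, e' i = e i) ∧ (∀ i < k, f' i = f i) := by
  let φ : V →ₗ[K] (Fin k ⊕ Fin k → K) :=
    LinearMap.pi (Sum.elim (fun i => B (e i)) (fun i => B (f i)))
  have hφ : LinearMap.ker φ ≠ ⊥ := by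
    apply LinearMap.ker_ne_bot_of_finrank_lt
    simpa [two_mul] using hk
  obtain ⟨x, hxφ, hx⟩ := Submodule.exists_mem_ne_zero_of_ne_bot hφ
  rw [LinearMap.mem_ker] at hxφ
  obtain ⟨e', f', h', he, hf, -⟩ := h.exists_succ_of_orthogonal hB hn hx
    (fun i hi => by simpa [φ] using congrFun hxφ (Sum.inl ⟨i, hi⟩))
    (fun i hi => by simpa [φ] using congrFun hxφ (Sum.inr ⟨i, hi⟩))
  exact ⟨e', f', h', he, hf⟩

/-- A hyperbolic family extends to a symplectic basis. -/
theorem exists_extend [FiniteDimensional K V] (h : IsHyperbolicFamily B k e f) (hB : B.IsAlt)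
    (hn : ∀ x ≠ 0, ∃ y, B y x ≠ 0) {m : ℕ} (hkm : k ≤ m) (hm : 2 * m ≤ Module.finrank K V) :
    ∃ e' f' : ℕ → V, IsHyperbolicFamily B m e' f' ∧
      (∀ i < k, e' i = e i) ∧ (∀ i < k, f' i = f i) := by
  induction m, hkm using Nat.le_induction with
  | base => exact ⟨e, f, h, fun _ _ => rfl, fun _ _ => rfl⟩
  | succ n hkn ih =>
    obtain ⟨e₁, f₁, h₁, he₁, hf₁⟩ := ih (by omega)
    obtain ⟨e₂, f₂, h₂, he₂, hf₂⟩ := h₁.exists_succ hB hn (by omega)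
    exact ⟨e₂, f₂, h₂, fun i hi => (he₂ i (by omega)).trans (he₁ i hi),
      fun i hi => (hf₂ i (by omega)).trans (hf₁ i hi)⟩

end IsHyperbolicFamily

theorem sympJ_transpose (m : ℕ) : (sympJ m)ᵀ = -sympJ m := by
  simp [sympJ_eq_neg_J]

/-- The bilinear form with matrix `sympJ m`. -/
def sympForm (m : ℕ) : LinearMap.BilinForm ℝ (Fin m ⊕ Fin m → ℝ) :=
  Matrix.toBilin' (sympJ m)

theorem sympForm_apply (m : ℕ) (u v : Fin m ⊕ Fin m → ℝ) :
    sympForm m u v = u ⬝ᵥ sympJ m *ᵥ v :=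
  Matrix.toBilin'_apply' _ _ _

theorem sympForm_isAlt (m : ℕ) : (sympForm m).IsAlt := by
  intro u
  have h : sympForm m u u = -sympForm m u u := by
    conv_lhs => rw [sympForm_apply, dotProduct_mulVec, ← mulVec_transpose, sympJ_transpose,
      dotProduct_comm, neg_mulVec, dotProduct_neg, ← sympForm_apply]
  linarith

theorem exists_sympForm_ne_zero (m : ℕ) (x : Fin m ⊕ Fin m → ℝ) (hx : x ≠ 0) :
    ∃ y, sympForm m y x ≠ 0 := by
  by_contra! h
  have h0 : sympJ m *ᵥ x = 0 :=
    dotProduct_eq_zero _ fun y => by rw [dotProduct_comm, ← sympForm_apply, h]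
  apply hx
  have h1 : sympJ m * sympJ m = -1 := by simp [sympJ_eq_neg_J, J_squared]
  have h2 : sympJ m *ᵥ (sympJ m *ᵥ x) = 0 := by rw [h0, mulVec_zero]
  simpa [mulVec_mulVec, h1, neg_mulVec] using h2

theorem mul_sympJ_mul_transpose_apply {ι κ : Type*} (m : ℕ) (A : Matrix ι (Fin m ⊕ Fin m) ℝ)
    (C : Matrix κ (Fin m ⊕ Fin m) ℝ) (i : ι) (j : κ) :
    (A * sympJ m * Cᵀ) i j = sympForm m (A i) (C j) := by
  rw [sympForm_apply, Matrix.mul_assoc]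
  rfl

/-- The matrix whose rows are the vectors of a full hyperbolic family is symplectic. -/
theorem IsHyperbolicFamily.mul_sympJ_mul_transpose {m : ℕ} {e f : ℕ → Fin m ⊕ Fin m → ℝ}
    (h : IsHyperbolicFamily (sympForm m) m e f) :
    let S : Matrix (Fin m ⊕ Fin m) (Fin m ⊕ Fin m) ℝ :=
      Matrix.of (Sum.elim (fun i => e i) (fun i => f i))
    S * sympJ m * Sᵀ = sympJ m := by
  intro S
  ext i j
  rw [mul_sympJ_mul_transpose_apply]
  rcases i with i | i <;> rcases j with j | j
  · change sympForm m (e i) (e j) = _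
    simpa [sympJ] using h.left_left i i.2 j j.2
  · change sympForm m (e i) (f j) = _
    simpa [sympJ, Matrix.one_apply, Fin.ext_iff] using h.left_right i i.2 j j.2
  · change sympForm m (f i) (e j) = _
    rw [← (sympForm_isAlt m).neg_eq, h.left_right j j.2 i i.2]
    simp [sympJ, Matrix.one_apply, Fin.ext_iff, eq_comm]
  · change sympForm m (f i) (f j) = _
    simpa [sympJ] using h.right_right i i.2 j j.2

/-- If `S` is symplectic, then `Sᵀ * N * S` is symplectically congruent to `N`. -/
theorem exists_sympJ_congr {m : ℕ} {S G N : Matrix (Fin m ⊕ Fin m) (Fin m ⊕ Fin m) ℝ}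
    (hS : S * sympJ m * Sᵀ = sympJ m) (hG : G = Sᵀ * N * S) :
    ∃ T : Matrix (Fin m ⊕ Fin m) (Fin m ⊕ Fin m) ℝ,
      Tᵀ * sympJ m * T = sympJ m ∧ Tᵀ * G * T = N := by
  have hS' : S ∈ symplecticGroup (Fin m) ℝ := by
    rw [SymplecticGroup.mem_iff]
    simpa [sympJ_eq_neg_J] using hS
  have hu : IsUnit S.det := SymplecticGroup.symplectic_det hS'
  have hST : S * S⁻¹ = 1 := Matrix.mul_nonsing_inv _ hu
  have hTS : S⁻¹ᵀ * Sᵀ = 1 := by rw [← transpose_mul, hST, transpose_one]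
  have hJ : Sᵀ * sympJ m * S = sympJ m := by
    have := SymplecticGroup.mem_iff.1 (SymplecticGroup.transpose_mem hS')
    simpa [sympJ_eq_neg_J] using this
  have key (M : Matrix (Fin m ⊕ Fin m) (Fin m ⊕ Fin m) ℝ) :
      S⁻¹ᵀ * (Sᵀ * M * S) * S⁻¹ = M := by
    calc S⁻¹ᵀ * (Sᵀ * M * S) * S⁻¹ = (S⁻¹ᵀ * Sᵀ) * M * (S * S⁻¹) := by
          simp only [Matrix.mul_assoc]
      _ = M := by rw [hST, hTS, Matrix.one_mul, Matrix.mul_one]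
  exact ⟨S⁻¹, by simpa only [hJ] using key (sympJ m), by rw [hG, key]⟩

/-- A rotation bringing a nonzero `3 × 3` antisymmetric matrix to normal form. -/
theorem exists_orthogonal_conj_antisymm {p q r c : ℝ} (hc : 0 < c)
    (h : p ^ 2 + q ^ 2 + r ^ 2 = c ^ 2) :
    ∃ U : Matrix (Fin 3) (Fin 3) ℝ, U * Uᵀ = 1 ∧
      U * !![0, r, -q; -r, 0, p; q, -p, 0] * Uᵀ = !![0, c, 0; -c, 0, 0; 0, 0, 0] := by
  obtain ⟨x, rfl⟩ : ∃ x, p = c * x := ⟨p / c, by field_simp⟩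
  obtain ⟨y, rfl⟩ : ∃ y, q = c * y := ⟨q / c, by field_simp⟩
  obtain ⟨z, rfl⟩ : ∃ z, r = c * z := ⟨r / c, by field_simp⟩
  have h1 : x ^ 2 + y ^ 2 + z ^ 2 = 1 := by
    have : c ^ 2 * (x ^ 2 + y ^ 2 + z ^ 2) = c ^ 2 * 1 := by linarith
    exact mul_left_cancel₀ (by positivity) this
  obtain ⟨s, hs0, hs⟩ : ∃ s : ℝ, 0 ≤ s ∧ s ^ 2 = x ^ 2 + y ^ 2 :=
    ⟨√(x ^ 2 + y ^ 2), Real.sqrt_nonneg _, Real.sq_sqrt (by positivity)⟩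
  rcases hs0.eq_or_lt with rfl | hs0
  · have hx : x = 0 := by nlinarith [sq_nonneg x, sq_nonneg y]
    have hy : y = 0 := by nlinarith [sq_nonneg x, sq_nonneg y]
    subst hx hy
    have hz : z * z = 1 := by linarith
    refine ⟨!![1, 0, 0; 0, z, 0; 0, 0, z], ?_, ?_⟩
    · ext i j
      fin_cases i <;> fin_cases j <;> simp [Matrix.mul_apply, Fin.sum_univ_three, hz]
    · ext i j
      fin_cases i <;> fin_cases j <;>
        simp [Matrix.mul_apply, Fin.sum_univ_three] <;> grind
  · obtain ⟨a, rfl⟩ : ∃ a, x = s * a := ⟨x / s, by field_simp⟩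
    obtain ⟨b, rfl⟩ : ∃ b, y = s * b := ⟨y / s, by field_simp⟩
    have hab : a ^ 2 + b ^ 2 = 1 := by
      have : s ^ 2 * (a ^ 2 + b ^ 2) = s ^ 2 * 1 := by linarith
      exact mul_left_cancel₀ (by positivity) this
    have hzs : z ^ 2 + s ^ 2 = 1 := by linarith
    clear h h1 hs
    have hb : b ^ 2 = 1 - a ^ 2 := by linarith
    have hz : z ^ 2 = 1 - s ^ 2 := by linarith
    refine ⟨!![-b, a, 0; -(z * a), -(z * b), s; s * a, s * b, z], ?_, ?_⟩
    · ext i j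
      fin_cases i <;> fin_cases j <;> simp [Matrix.mul_apply, Fin.sum_univ_three] <;> grind
    · ext i j
      fin_cases i <;> fin_cases j <;> simp [Matrix.mul_apply, Fin.sum_univ_three] <;> grind

/-- Rotating the rows of `Z`, only the first two have a nonzero symplectic product. -/
theorem exists_orthogonal_mul_sympForm {m : ℕ} (Z : Matrix (Fin 3) (Fin m ⊕ Fin m) ℝ) {ω : ℝ}
    (hω : 0 < ω) (htr : ((Z * sympJ m * Zᵀ) ^ 2).trace = -2 * ω ^ 4) :
    ∃ U : Matrix (Fin 3) (Fin 3) ℝ, Uᵀ * U = 1 ∧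
      sympForm m ((U * Z) 0) ((U * Z) 1) = ω ^ 2 ∧
      sympForm m ((U * Z) 0) ((U * Z) 2) = 0 ∧ sympForm m ((U * Z) 1) ((U * Z) 2) = 0 := by
  have hA : ∀ i j, (Z * sympJ m * Zᵀ) i j = -(Z * sympJ m * Zᵀ) j i := fun i j => by
    rw [mul_sympJ_mul_transpose_apply, mul_sympJ_mul_transpose_apply, (sympForm_isAlt m).neg_eq]
  set L := Z * sympJ m * Zᵀ with hLdef
  have hL : L = !![0, L 0 1, -L 2 0; -L 0 1, 0, L 1 2; L 2 0, -L 1 2, 0] := by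
    ext i j
    have := hA i j
    fin_cases i <;> fin_cases j <;> simp at this ⊢ <;> linarith
  have hc : (L 1 2) ^ 2 + (L 2 0) ^ 2 + (L 0 1) ^ 2 = (ω ^ 2) ^ 2 := by
    rw [hL] at htr
    simp [pow_two, Matrix.trace, Fin.sum_univ_three] at htr
    linarith
  obtain ⟨U, hU, hUL⟩ := exists_orthogonal_conj_antisymm (pow_pos hω 2) hc
  rw [← hL] at hUL
  have hUZ : (U * Z) * sympJ m * (U * Z)ᵀ = U * L * Uᵀ := by
    simp only [hLdef, transpose_mul, Matrix.mul_assoc]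
  refine ⟨U, mul_eq_one_comm.1 hU, ?_, ?_, ?_⟩ <;>
    rw [← mul_sympJ_mul_transpose_apply, hUZ, hUL] <;> simp

/-- Three vectors, the first two of which pair nontrivially and are orthogonal to the third one,
are linearly independent if and only if the third one is nonzero. -/
theorem rank_eq_three_iff {m : ℕ} {Y : Matrix (Fin 3) (Fin m ⊕ Fin m) ℝ}
    (h01 : sympForm m (Y 0) (Y 1) ≠ 0) (h02 : sympForm m (Y 0) (Y 2) = 0)
    (h12 : sympForm m (Y 1) (Y 2) = 0) : Y.rank = 3 ↔ Y 2 ≠ 0 := by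
  constructor
  · intro h
    rw [rank_eq_finrank_span_row] at h
    have hli : LinearIndependent ℝ Y.row :=
      linearIndependent_iff_card_eq_finrank_span.2 (by simpa [Set.finrank] using h.symm)
    exact hli.ne_zero 2
  · intro h
    have hli : LinearIndependent ℝ Y.row := by
      rw [Fintype.linearIndependent_iff]
      intro g hg
      rw [Fin.sum_univ_three] at hg
      change g 0 • Y 0 + g 1 • Y 1 + g 2 • Y 2 = 0 at hg
      have h1 : g 1 = 0 := by
        have := congrArg (sympForm m (Y 0)) hg
        simpa [(sympForm_isAlt m).self_eq_zero, h02, h01] using this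
      have h0 : g 0 = 0 := by
        have := congrArg (sympForm m (Y 1)) hg
        rw [← (sympForm_isAlt m).neg_eq] at h01
        simpa [(sympForm_isAlt m).self_eq_zero, h12, neg_ne_zero.1 h01] using this
      have h2 : g 2 = 0 := by simpa [h0, h1, h] using hg
      intro i
      fin_cases i <;> assumption
    simpa using hli.rank_matrix

theorem mul_sympJ_mul_transpose_eq_zero_of_rank_le_one {ι : Type*} [Finite ι] {m : ℕ}
    {Z : Matrix ι (Fin m ⊕ Fin m) ℝ} (hZ : Z.rank ≤ 1) : Z * sympJ m * Zᵀ = 0 := by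
  rw [rank_eq_finrank_span_row, finrank_le_one_iff] at hZ
  obtain ⟨v, hv⟩ := hZ
  have hrow (i : ι) : ∃ c : ℝ, Z i = c • (v : Fin m ⊕ Fin m → ℝ) := by
    obtain ⟨c, hc⟩ := hv ⟨Z.row i, Submodule.subset_span ⟨i, rfl⟩⟩
    exact ⟨c, (congrArg Subtype.val hc).symm⟩
  ext i j
  obtain ⟨a, ha⟩ := hrow i
  obtain ⟨b, hb⟩ := hrow j
  rw [mul_sympJ_mul_transpose_apply, ha, hb]
  simp [(sympForm_isAlt m).self_eq_zero]

theorem transpose_mul_NMat_mul_apply {m q : ℕ} (hm : 2 ≤ m) (hq : q ≤ 1) (ω : ℝ)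
    (e f : ℕ → Fin m ⊕ Fin m → ℝ) (i j : Fin m ⊕ Fin m) :
    let S : Matrix (Fin m ⊕ Fin m) (Fin m ⊕ Fin m) ℝ :=
      Matrix.of (Sum.elim (fun i => e i) (fun i => f i))
    (Sᵀ * NMat m 1 q (fun _ => ω) * S) i j =
      ω ^ 2 * (e 0 i * e 0 j) + ω ^ 2 * (f 0 i * f 0 j) + q * (f 1 i * f 1 j) := by
  obtain ⟨n, rfl⟩ := Nat.exists_eq_add_of_le' hm
  intro S
  rw [NMat, Matrix.mul_apply]
  simp only [Matrix.mul_diagonal, Fintype.sum_sum_type, Fin.sum_univ_succ]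
  interval_cases q <;> simp [S] <;> ring

/-- The two strata of the reduced spatial `n`-body problem at nonzero angular
momentum. If `Z` is a real `3×2m` matrix with nonzero angular momentum
`L = Z·J·Zᵀ`, `ω > 0` the unique positive real with `trace(L²) = -2ω⁴`, then its
Gram matrix is symplectically congruent to `N(1,1,ω)` when `rank Z = 3` (spatial
stratum), to `N(1,0,ω)` when `rank Z = 2` (planar stratum), and `rank Z = 1` is
impossible. -/
theorem spatial_reduced_space_strata (m : ℕ) (hm : 2 ≤ m)
    (Z : Matrix (Fin 3) (Fin m ⊕ Fin m) ℝ)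
    (hL : Z * sympJ m * Zᵀ ≠ 0) (ω : ℝ) (hω : 0 < ω)
    (htr : ((Z * sympJ m * Zᵀ) ^ 2).trace = -2 * ω ^ 4) :
    (Z.rank = 3 → ∃ T : Matrix (Fin m ⊕ Fin m) (Fin m ⊕ Fin m) ℝ,
        Tᵀ * sympJ m * T = sympJ m ∧
        Tᵀ * (Zᵀ * Z) * T = NMat m 1 1 (fun _ => ω)) ∧
    (Z.rank = 2 → ∃ T : Matrix (Fin m ⊕ Fin m) (Fin m ⊕ Fin m) ℝ,
        Tᵀ * sympJ m * T = sympJ m ∧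
        Tᵀ * (Zᵀ * Z) * T = NMat m 1 0 (fun _ => ω)) ∧
    Z.rank ≠ 1 := by
  obtain ⟨U, hU, h01, h02, h12⟩ := exists_orthogonal_mul_sympForm Z hω htr
  have hrank : (U * Z).rank = Z.rank :=
    rank_mul_eq_right_of_isUnit_det U Z (isUnit_det_of_left_inverse hU)
  have hgram : Zᵀ * Z = (U * Z)ᵀ * (U * Z) := by
    rw [transpose_mul, Matrix.mul_assoc, ← Matrix.mul_assoc Uᵀ, hU, Matrix.one_mul]
  rw [hgram, ← hrank]
  have hrank1 : (U * Z).rank ≠ 1 := fun h =>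
    hL (mul_sympJ_mul_transpose_eq_zero_of_rank_le_one (hrank ▸ h).le)
  generalize U * Z = Y at *
  have hY : Y.rank = 3 ↔ Y 2 ≠ 0 := rank_eq_three_iff (by rw [h01]; positivity) h02 h12
  have halt := sympForm_isAlt m
  have hbase : IsHyperbolicFamily (sympForm m) 1 (fun _ => ω⁻¹ • Y 0) (fun _ => ω⁻¹ • Y 1) := by
    refine ⟨?_, ?_, ?_⟩ <;> intro i hi j hj
    · simp [halt.self_eq_zero]
    · simp [halt.self_eq_zero]
    · obtain rfl : i = j := by omega
      simp [h01]
      field_simp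
  refine ⟨fun h => ?_, fun h => ?_, hrank1⟩
  · obtain ⟨e₁, f₁, h₁, he₁, hf₁, hf₁'⟩ := hbase.exists_succ_of_orthogonal halt
      (exists_sympForm_ne_zero m) (hY.1 h) (fun _ _ => by simp [h02]) (fun _ _ => by simp [h12])
    obtain ⟨e, f, hef, he, hf⟩ := h₁.exists_extend halt (exists_sympForm_ne_zero m) hm
      (by simp [two_mul])
    refine exists_sympJ_congr hef.mul_sympJ_mul_transpose ?_
    ext i j
    rw [transpose_mul_NMat_mul_apply hm le_rfl, he 0 (by simp), hf 0 (by simp), hf 1 (by simp),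
      he₁ 0 (by simp), hf₁ 0 (by simp), hf₁', Matrix.mul_apply, Fin.sum_univ_three]
    simp
    field_simp
  · have hY2 : Y 2 = 0 := by
      by_contra h2
      rw [hY.2 h2] at h
      omega
    obtain ⟨e, f, hef, he, hf⟩ := hbase.exists_extend halt (exists_sympForm_ne_zero m)
      (by omega : 1 ≤ m) (by simp [two_mul])
    refine exists_sympJ_congr hef.mul_sympJ_mul_transpose ?_
    ext i j
    rw [transpose_mul_NMat_mul_apply hm zero_le_one, he 0 (by simp), hf 0 (by simp),
      Matrix.mul_apply, Fin.sum_univ_three]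
    simp [hY2]
    field_simp
end
end
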